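/- Let 0 < r < 1 and A > −1 with A ≠ 0. Then the function x ↦ |2A·r^{2x}|/((2 + A·(1 + r^{2x}))·x) is strictly decreasing on (0, ∞). In particular, the magnitudes of the eigenvalues μ_n = −2A·r^{2n}/((2 + A·(1 + r^{2n}))·n) of the Neumann-to-Dirichlet difference for a concentric disk inclusion decay strictly monotonically: |μ_{n+1}| < |μ_n| for every integer n ≥ 1. -/

import Mathlib

/-- The positivity of the denominator for contrasts `A > -1`. -/
lemma two_add_mul_one_add_pos {A s : ℝ} (hA : -1 < A) (hs0 : 0 < s) (hs1 : s < 1) :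
    0 < 2 + A * (1 + s) := by
  nlinarith [mul_pos (by linarith : 0 < A + 1) hs0]

lemma abs_div_two_add_mul_lt {A s t x y : ℝ} (hA : -1 < A) (hA0 : A ≠ 0) (ht : 0 < t)
    (hts : t < s) (hs : s < 1) (hx : 0 < x) (hxy : x < y) :
    |2 * A * t| / ((2 + A * (1 + t)) * y) < |2 * A * s| / ((2 + A * (1 + s)) * x) := by
  have hs0 : 0 < s := ht.trans hts
  have hDt := two_add_mul_one_add_pos hA ht (hts.trans hs)
  have hDs := two_add_mul_one_add_pos hA hs0 hs
  have hc : 0 < |2 * A| := abs_pos.mpr (mul_ne_zero two_ne_zero hA0)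
  rw [abs_mul _ t, abs_mul _ s, abs_of_pos ht, abs_of_pos hs0, mul_div_assoc, mul_div_assoc]
  refine mul_lt_mul_of_pos_left ?_ hc
  rw [div_lt_div_iff₀ (mul_pos hDt (hx.trans hxy)) (mul_pos hDs hx)]
  have h : t * (2 + A * (1 + s)) < s * (2 + A * (1 + t)) := by
    nlinarith [mul_pos (by linarith : 0 < 2 + A) (sub_pos.mpr hts)]
  calc t * ((2 + A * (1 + s)) * x) = t * (2 + A * (1 + s)) * x := by ring
    _ < s * (2 + A * (1 + t)) * y := mul_lt_mul h hxy.le hx (mul_pos hs0 hDt).le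
    _ = s * ((2 + A * (1 + t)) * y) := by ring

/-- For `0 < r < 1` and `A > −1`, `A ≠ 0`, the function
`x ↦ |2A r^{2x}| / ((2 + A(1 + r^{2x})) x)` is strictly decreasing on `(0, ∞)`; in
particular the magnitudes of the Neumann-to-Dirichlet eigenvalues
`μ_n = −2A r^{2n}/((2 + A(1 + r^{2n})) n)` decay strictly monotonically for `n ≥ 1`. -/
theorem stmt_16 (r A : ℝ) (hr0 : 0 < r) (hr1 : r < 1) (hA : -1 < A) (hA0 : A ≠ 0) :
    StrictAntiOn
      (fun x : ℝ => |2 * A * r ^ (2 * x)| / ((2 + A * (1 + r ^ (2 * x))) * x))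
      (Set.Ioi (0 : ℝ)) ∧
    ∀ n : ℕ, 1 ≤ n →
      |(-2 * A * r ^ (2 * (n + 1)) / ((2 + A * (1 + r ^ (2 * (n + 1)))) * ((n : ℝ) + 1)) : ℝ)| <
        |(-2 * A * r ^ (2 * n) / ((2 + A * (1 + r ^ (2 * n))) * (n : ℝ)) : ℝ)| := by
  refine ⟨fun x hx y _ hxy => ?_, fun n hn => ?_⟩
  · have hx0 : 0 < x := hx
    exact abs_div_two_add_mul_lt hA hA0 (Real.rpow_pos_of_pos hr0 _)
      (Real.rpow_lt_rpow_of_exponent_gt hr0 hr1 (by linarith))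
      (Real.rpow_lt_one hr0.le hr1 (by linarith)) hx0 hxy
  · have hn0 : (0 : ℝ) < n := by exact_mod_cast hn
    have hs : r ^ (2 * n) < 1 := pow_lt_one₀ hr0.le hr1 (by lia)
    have hts : r ^ (2 * (n + 1)) < r ^ (2 * n) := pow_lt_pow_right_of_lt_one₀ hr0 hr1 (by lia)
    have ht : 0 < r ^ (2 * (n + 1)) := pow_pos hr0 _
    have h := abs_div_two_add_mul_lt hA hA0 ht hts hs hn0 (lt_add_one (n : ℝ))
    have hDt := two_add_mul_one_add_pos hA ht (hts.trans hs)
    have hDs := two_add_mul_one_add_pos hA (ht.trans hts) hs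
    rw [abs_div, abs_div, abs_of_pos (mul_pos hDt (by linarith : (0 : ℝ) < n + 1)),
      abs_of_pos (mul_pos hDs hn0)]
    simpa only [neg_mul, abs_neg] using h
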